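/- For real u, v > 0, B(u, v) = 1/v + ∑_{n=1}^∞ (1-u)_n / ((n+v) · n!), where (x)_n denotes the Pochhammer symbol (ascending factorial). -/

import Mathlib

open MeasureTheory Set

lemma ring_choose_add_sub_one (a : ℝ) (n : ℕ) :
    Ring.choose (a + n - 1) n = (ascPochhammer ℝ n).eval a / (n.factorial : ℝ) := by
  have h := Ring.factorial_nsmul_multichoose_eq_ascPochhammer a n
  rw [Polynomial.ascPochhammer_smeval_eq_eval, nsmul_eq_mul] at h
  rw [Ring.choose, show a + n - 1 - n + 1 = a by ring, ← h]
  field_simp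

/-- The negative binomial series `(1 - t) ^ (-a) = ∑ (a)ₙ / n! tⁿ`. -/
lemma hasSum_ascPochhammer_one_sub_rpow (a : ℝ) {t : ℝ} (ht : |t| < 1) :
    HasSum (fun n : ℕ => (ascPochhammer ℝ n).eval a / (n.factorial : ℝ) * t ^ n)
      ((1 - t) ^ (-a)) := by
  have h := (Real.one_div_one_sub_rpow_hasFPowerSeriesOnBall_zero a).hasSum (y := t)
    (by simpa [enorm_eq_nnnorm, ← NNReal.coe_lt_coe] using ht)
  rw [Real.rpow_neg (by linarith [(abs_lt.1 ht).2])]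
  simpa [FormalMultilinearSeries.ofScalars_apply_eq, ring_choose_add_sub_one, mul_comm] using h

/-- The sign of `(a)ₙ` is eventually constant. -/
lemma exists_abs_ascPochhammer_eval_eq (a : ℝ) :
    ∃ (N : ℕ) (s : ℝ), ∀ n ≥ N,
      |(ascPochhammer ℝ n).eval a| = s * (ascPochhammer ℝ n).eval a := by
  obtain ⟨N, hN⟩ := exists_nat_ge (-a)
  refine ⟨N, SignType.sign ((ascPochhammer ℝ N).eval a), fun n hn => ?_⟩
  induction n, hn using Nat.le_induction with
  | base => exact (sign_mul_self _).symm
  | succ n hn ih =>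
    have : (N : ℝ) ≤ n := by exact_mod_cast hn
    rw [ascPochhammer_succ_eval, abs_mul, ih, abs_of_nonneg (a := a + n) (by linarith), mul_assoc]

lemma intervalIntegrable_rpow_mul_one_sub_rpow {u v : ℝ} (hu : 0 < u) (hv : 0 < v) :
    IntervalIntegrable (fun t : ℝ => t ^ (v - 1) * (1 - t) ^ (u - 1)) volume 0 1 := by
  refine (Complex.betaIntegral_convergent (u := v) (v := u) (by simpa) (by simpa)).norm.congr ?_
  intro t ht
  rw [uIoc_of_le zero_le_one] at ht
  have h1 : ((t : ℂ) ^ ((v : ℂ) - 1)) = ((t ^ (v - 1) : ℝ) : ℂ) := by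
    rw [Complex.ofReal_cpow ht.1.le]; push_cast; rfl
  have h2 : ((1 - t : ℂ) ^ ((u : ℂ) - 1)) = (((1 - t) ^ (u - 1) : ℝ) : ℂ) := by
    rw [Complex.ofReal_cpow (by linarith [ht.2])]; push_cast; rfl
  have h3 := Real.rpow_nonneg ht.1.le (v - 1)
  have h4 := Real.rpow_nonneg (sub_nonneg.2 ht.2) (u - 1)
  simp only [h1, h2]
  rw [← Complex.ofReal_mul, Complex.norm_real, Real.norm_of_nonneg (mul_nonneg h3 h4)]

lemma hasSum_beta {u v : ℝ} (hu : 0 < u) (hv : 0 < v) :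
    HasSum (fun n : ℕ => (ascPochhammer ℝ n).eval (1 - u) / (((n : ℝ) + v) * (n.factorial : ℝ)))
      (∫ t in (0:ℝ)..1, t ^ (v - 1) * (1 - t) ^ (u - 1)) := by
  set c : ℕ → ℝ := fun n => (ascPochhammer ℝ n).eval (1 - u) / (n.factorial : ℝ) with hc
  set F : ℕ → ℝ → ℝ := fun n t => c n * t ^ ((n : ℝ) + v - 1) with hF
  have hF_int (n : ℕ) : IntervalIntegrable (F n) volume 0 1 :=
    (intervalIntegral.intervalIntegrable_rpow' (by linarith [n.cast_nonneg (α := ℝ)])).const_mul _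
  have hF_sum {t : ℝ} (ht : t ∈ Ioo (0:ℝ) 1) :
      HasSum (fun n => F n t) (t ^ (v - 1) * (1 - t) ^ (u - 1)) := by
    have h := (hasSum_ascPochhammer_one_sub_rpow (1 - u)
      (abs_lt.2 ⟨by linarith [ht.1], ht.2⟩)).mul_left (t ^ (v - 1))
    rw [neg_sub] at h
    refine h.congr_fun fun n => ?_
    simp only [hF, hc]
    rw [add_sub_assoc, Real.rpow_add ht.1, Real.rpow_natCast]
    ring
  obtain ⟨N, s, hs⟩ := exists_abs_ascPochhammer_eval_eq (1 - u)
  have habs_sum {t : ℝ} (ht : t ∈ Ioo (0:ℝ) 1) :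
      HasSum (fun n => |F n t|) (s * (t ^ (v - 1) * (1 - t) ^ (u - 1))
        + ∑ n ∈ Finset.range N, (|F n t| - s * F n t)) := by
    have h0 : ∀ n ∉ Finset.range N, |F n t| - s * F n t = 0 := by
      intro n hn
      have hp := Real.rpow_pos_of_pos ht.1 ((n : ℝ) + v - 1)
      simp only [hF, hc]
      rw [abs_mul, abs_div, hs n (by simpa using hn), abs_of_pos hp, Nat.abs_cast]
      ring
    refine (((hF_sum ht).mul_left s).add (hasSum_sum_of_ne_finset_zero h0)).congr_fun fun n => ?_
    ring
  have hmem : ∀ᵐ t : ℝ, t ∈ uIoc (0:ℝ) 1 → t ∈ Ioo (0:ℝ) 1 := by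
    filter_upwards [Measure.ae_ne volume (1:ℝ)] with t ht h
    rw [uIoc_of_le zero_le_one] at h
    exact ⟨h.1, lt_of_le_of_ne h.2 ht⟩
  have key := intervalIntegral.hasSum_integral_of_dominated_convergence (μ := volume)
    (a := 0) (b := 1) (F := F) (f := fun t => t ^ (v - 1) * (1 - t) ^ (u - 1))
    (fun n t => |F n t|) (fun n => (hF_int n).def'.aestronglyMeasurable)
    (fun n => .of_forall fun t _ => le_rfl)
    (hmem.mono fun t ht h => (habs_sum (ht h)).summable) ?_
    (hmem.mono fun t ht h => hF_sum (ht h))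
  · refine key.congr_fun fun n => ?_
    have hn : (0 : ℝ) < n + v := by positivity
    simp only [hF, hc]
    rw [intervalIntegral.integral_const_mul, integral_rpow (.inl (by linarith)),
      sub_add_cancel, Real.one_rpow, Real.zero_rpow hn.ne']
    field_simp
    ring
  · have hI : IntervalIntegrable (fun t => s * (t ^ (v - 1) * (1 - t) ^ (u - 1))
        + ∑ n ∈ Finset.range N, (|F n t| - s * F n t)) volume 0 1 := by
      refine ((intervalIntegrable_rpow_mul_one_sub_rpow hu hv).const_mul s).add ?_
      have := IntervalIntegrable.sum (Finset.range N)
        (fun n _ => (hF_int n).abs.sub ((hF_int n).const_mul s))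
      simpa only [Finset.sum_fn] using this
    refine hI.congr_ae ?_
    exact (ae_restrict_iff' measurableSet_uIoc).2
      (hmem.mono fun t ht h => (habs_sum (ht h)).tsum_eq.symm)

theorem beta_series (u v : ℝ) (hu : 0 < u) (hv : 0 < v) :
    (∫ t in (0:ℝ)..1, t ^ (v - 1) * (1 - t) ^ (u - 1))
      = 1 / v + ∑' n : ℕ,
          (ascPochhammer ℝ (n + 1)).eval (1 - u) / (((n : ℝ) + 1 + v) * (Nat.factorial (n + 1) : ℝ)) := by
  have h := hasSum_beta hu hv
  rw [← h.tsum_eq, h.summable.tsum_eq_zero_add]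
  simp
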